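/- arXiv:1608.06621 — 2 statements merged into one kernel-verified Lean document; each statement's English description precedes it below -/
import Mathlib

section
/- There exists k_0 such that for every integer k ≥ k_0 there exists an oriented k-uniform hypergraph with Property O having at most (k² ln k)·k! edges (i.e., the upper bound f(k) ≤ (k² ln k)·k! holds for all sufficiently large k). -/
/-- An ordered `k`-set (`k`-tuple of distinct elements of `V`), given as an
embedding `Fin k ↪ V`, is *consistent* with a (strict) linear order `r` on `V`
if its entries are increasing with respect to `r`. -/
def Consistent {k : ℕ} {V : Type*} (r : V → V → Prop) (e : Fin k ↪ V) : Prop :=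
  ∀ i j : Fin k, i < j → r (e i) (e j)

/-- An *oriented `k`-uniform hypergraph* on `V`: a family of `k`-tuples of
distinct elements of `V` (embeddings `Fin k ↪ V`) such that no two tuples have
the same underlying `k`-element set. -/
structure OrientedHypergraph (k : ℕ) (V : Type*) where
  edges : Finset (Fin k ↪ V)
  eq_of_range_eq : ∀ e ∈ edges, ∀ f ∈ edges, Set.range ⇑e = Set.range ⇑f → e = f

/-- *Property O*: for every linear order (given by its strict order relation `r`)
on the vertex set, some edge is consistent with it. -/
def PropertyO {k : ℕ} {V : Type*} (H : OrientedHypergraph k V) : Prop :=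
  ∀ r : V → V → Prop, IsStrictTotalOrder V r → ∃ e ∈ H.edges, Consistent r e

/-- A *`k`-tournament*: an oriented `k`-uniform hypergraph containing a tuple
for every `k`-element subset of the vertex set (such a tuple is unique by
`eq_of_range_eq`). -/
def IsTournament {k : ℕ} {V : Type*} (H : OrientedHypergraph k V) : Prop :=
  ∀ S : Finset V, S.card = k → ∃ e ∈ H.edges, Set.range ⇑e = ↑S

theorem pO_exists_perm {n : ℕ} (r : Fin n → Fin n → Prop) (hr : IsStrictTotalOrder (Fin n) r) :
    ∃ π : Equiv.Perm (Fin n), ∀ a b, π a < π b → r a b := by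
  classical
  let c : Fin n → ℕ := fun a => (Finset.univ.filter (fun b => r b a)).card
  have hirr : ∀ a, ¬ r a a := fun a => irrefl_of r a
  have htr : ∀ a b c, r a b → r b c → r a c := fun a b c => trans_of r
  have htri : ∀ a b, r a b ∨ a = b ∨ r b a := fun a b => trichotomous_of r a b
  have hc : ∀ a, c a < n := by
    intro a
    have : c a < (Finset.univ : Finset (Fin n)).card := by
      apply Finset.card_lt_card
      refine (Finset.ssubset_univ_iff).2 ?_
      intro h
      have : a ∈ Finset.univ.filter (fun b => r b a) := by rw [h]; simp
      simp at this
      exact hirr a this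
    simpa using this
  have hmono : ∀ a b, r a b → c a < c b := by
    intro a b hab
    apply Finset.card_lt_card
    rw [Finset.ssubset_iff_of_subset]
    · exact ⟨a, by simpa using hab, by simpa using hirr a⟩
    · intro x hx
      simp at hx ⊢
      exact htr _ _ _ hx hab
  have hinj : Function.Injective (fun a => (⟨c a, hc a⟩ : Fin n)) := by
    intro a b hab
    have hab' : c a = c b := by simpa using hab
    rcases htri a b with h | h | h
    · have := hmono _ _ h; omega
    · exact h
    · have := hmono _ _ h; omega
  refine ⟨Equiv.ofBijective _ (Finite.injective_iff_bijective.1 hinj), ?_⟩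
  intro a b hab
  have hab' : c a < c b := by simpa using hab
  rcases htri a b with h | h | h
  · exact h
  · subst h; omega
  · have := hmono _ _ h; omega

theorem pO_core (k n m : ℕ) (hm : m ≤ n.choose k)
    (h : n.factorial * (k.factorial - 1) ^ m < k.factorial ^ m) :
    ∃ H : OrientedHypergraph k (Fin n), PropertyO H ∧ H.edges.card ≤ m := by
  classical
  obtain ⟨S, hS, hSm⟩ := Finset.exists_subset_card_eq
    (s := Finset.powersetCard k (Finset.univ : Finset (Fin n))) (n := m) (by simpa using hm)
  have hcard : ∀ A : S, A.1.card = k := fun A => (Finset.mem_powersetCard.1 (hS A.2)).2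
  let ed : (A : S) → Equiv.Perm (Fin k) → (Fin k ↪ Fin n) := fun A σ =>
    σ.toEmbedding.trans (A.1.orderEmbOfFin (hcard A)).toEmbedding
  have hrange : ∀ A σ, Set.range (ed A σ) = (A.1 : Set (Fin n)) := by
    intro A σ
    have : (ed A σ : Fin k → Fin n) = (A.1.orderEmbOfFin (hcard A)) ∘ σ := rfl
    rw [this, σ.surjective.range_comp, Finset.range_orderEmbOfFin]
  let good : Equiv.Perm (Fin n) → S → Equiv.Perm (Fin k) → Prop := fun π A σ =>
    StrictMono (fun i => π (ed A σ i))
  have hex : ∀ π A, ∃ σ, good π A σ := by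
    intro π A
    let f : Fin k → Fin n := fun i => π (A.1.orderEmbOfFin (hcard A) i)
    refine ⟨Tuple.sort f, ?_⟩
    have h1 : Monotone (f ∘ Tuple.sort f) := Tuple.monotone_sort f
    have h2 : Function.Injective (f ∘ Tuple.sort f) :=
      (π.injective.comp (A.1.orderEmbOfFin (hcard A)).injective).comp (Tuple.sort f).injective
    exact h1.strictMono_of_injective h2
  have key : ∃ o : S → Equiv.Perm (Fin k), ∀ π, ∃ A, good π A (o A) := by
    by_contra hcon
    push Not at hcon
    let bad : Equiv.Perm (Fin n) → Finset (S → Equiv.Perm (Fin k)) := fun π =>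
      Fintype.piFinset (fun A => Finset.univ.filter (fun σ => ¬ good π A σ))
    have hb : ∀ π, (bad π).card ≤ (k.factorial - 1) ^ m := by
      intro π
      rw [Fintype.card_piFinset]
      calc _ ≤ ∏ _A : S, (k.factorial - 1) := by
            apply Finset.prod_le_prod' 
            intro A _
            obtain ⟨σ, hσ⟩ := hex π A
            have : (Finset.univ.filter (fun σ => ¬ good π A σ)).card
                < (Finset.univ : Finset (Equiv.Perm (Fin k))).card := by
              apply Finset.card_lt_card
              refine (Finset.ssubset_univ_iff).2 ?_
              intro h
              have h' : σ ∈ Finset.univ.filter (fun σ => ¬ good π A σ) := by rw [h]; simp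
              exact (Finset.mem_filter.1 h').2 hσ
            rw [Finset.card_univ, Fintype.card_perm, Fintype.card_fin] at this
            omega
        _ = _ := by simp [hSm]
    have hU : (Finset.univ : Finset (S → Equiv.Perm (Fin k))) ⊆ Finset.univ.biUnion bad := by
      intro o _
      obtain ⟨π, hπ⟩ := hcon o
      refine Finset.mem_biUnion.2 ⟨π, Finset.mem_univ _, ?_⟩
      simp only [bad, Fintype.mem_piFinset]
      intro A
      exact Finset.mem_filter.2 ⟨Finset.mem_univ _, hπ A⟩
    have h1 := Finset.card_le_card hU
    have h2 := Finset.card_biUnion_le_card_mul Finset.univ bad _ (fun π _ => hb π)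
    have h3 : (Finset.univ : Finset (S → Equiv.Perm (Fin k))).card = k.factorial ^ m := by
      simp [Fintype.card_perm, hSm]
    have h4 : (Finset.univ : Finset (Equiv.Perm (Fin n))).card = n.factorial := by
      simp [Fintype.card_perm]
    rw [h3] at h1
    rw [h4] at h2
    omega
  obtain ⟨o, ho⟩ := key
  refine ⟨⟨Finset.univ.image (fun A : S => ed A (o A)), ?_⟩, ?_, ?_⟩
  · intro e he f hf hef
    obtain ⟨A, _, rfl⟩ := Finset.mem_image.1 he
    obtain ⟨B, _, rfl⟩ := Finset.mem_image.1 hf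
    rw [hrange, hrange] at hef
    have : A = B := Subtype.ext (Finset.coe_injective hef)
    rw [this]
  · intro r hr
    obtain ⟨π, hπ⟩ := pO_exists_perm r hr
    obtain ⟨A, hA⟩ := ho π
    refine ⟨ed A (o A), Finset.mem_image_of_mem _ (Finset.mem_univ _), ?_⟩
    intro i j hij
    exact hπ _ _ (hA hij)
  · refine Finset.card_image_le.trans ?_
    simp [hSm]

theorem pO_factorial (k : ℕ) : (k.factorial : ℝ) ≤ (((k : ℝ) + 1) / 2) ^ k := by
  induction k with
  | zero => simp
  | succ k ih =>
    have hk : (0 : ℝ) < (k : ℝ) + 1 := by positivity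
    have hB : (2 : ℝ) ≤ (1 + 1 / ((k : ℝ) + 1)) ^ (k + 1) := by
      have := one_add_mul_le_pow (a := 1 / ((k : ℝ) + 1))
        (by have : (0 : ℝ) ≤ 1 / ((k : ℝ) + 1) := by positivity
            linarith) (k + 1)
      push_cast at this
      rw [mul_one_div_cancel hk.ne'] at this
      linarith
    rw [Nat.factorial_succ]
    push_cast
    calc ((k : ℝ) + 1) * (k.factorial : ℝ) ≤ ((k : ℝ) + 1) * (((k : ℝ) + 1) / 2) ^ k := by gcongr
      _ = 2 * (((k : ℝ) + 1) / 2) ^ (k + 1) := by rw [pow_succ]; ring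
      _ ≤ (1 + 1 / ((k : ℝ) + 1)) ^ (k + 1) * (((k : ℝ) + 1) / 2) ^ (k + 1) := by gcongr
      _ = (((k : ℝ) + 1 + 1) / 2) ^ (k + 1) := by
        rw [← mul_pow]; congr 1; field_simp

theorem pO_choose (k n : ℕ) (hk : 20 ≤ k) (hn : (k : ℝ) ^ 2 / 2 - 1 ≤ n)
    (hp : (k : ℝ) ^ 3 ≤ (3 / 2 : ℝ) ^ k) :
    (k : ℝ) ^ 2 * Real.log k * k.factorial ≤ n.choose k := by
  have hkR : (20 : ℝ) ≤ k := by exact_mod_cast hk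
  have hkn : k ≤ n := by
    have : (k : ℝ) ≤ n := by nlinarith
    exact_mod_cast this
  have hf : (0 : ℝ) < k.factorial := by exact_mod_cast k.factorial_pos
  have h1 : ((n : ℝ) - k) ^ k ≤ k.factorial * n.choose k := by
    have := Nat.pow_sub_le_descFactorial n k
    rw [Nat.descFactorial_eq_factorial_mul_choose] at this
    have h2 : ((n - k : ℕ) : ℝ) ^ k ≤ ((n + 1 - k : ℕ) : ℝ) ^ k := by
      gcongr; omega
    rw [Nat.cast_sub hkn] at h2
    refine h2.trans ?_
    exact_mod_cast this
  have h3 : (3 / 2 : ℝ) * (((k : ℝ) + 1) / 2) ^ 2 ≤ (n : ℝ) - k := by nlinarith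
  have hlog : Real.log k ≤ k := (Real.log_le_sub_one_of_pos (by linarith)).trans (by linarith)
  have h4 : (k.factorial : ℝ) * ((k : ℝ) ^ 2 * Real.log k * k.factorial)
      ≤ k.factorial * n.choose k := by
    calc (k.factorial : ℝ) * ((k : ℝ) ^ 2 * Real.log k * k.factorial)
        ≤ k.factorial * ((k : ℝ) ^ 2 * k * k.factorial) := by gcongr
      _ = (k : ℝ) ^ 3 * (k.factorial : ℝ) ^ 2 := by ring
      _ ≤ (3 / 2 : ℝ) ^ k * ((((k : ℝ) + 1) / 2) ^ k) ^ 2 := by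
        gcongr; exact pO_factorial k
      _ = ((3 / 2 : ℝ) * (((k : ℝ) + 1) / 2) ^ 2) ^ k := by
        rw [mul_pow, ← pow_mul, ← pow_mul, mul_comm k 2]
      _ ≤ ((n : ℝ) - k) ^ k := by gcongr
      _ ≤ _ := h1
  exact le_of_mul_le_mul_left h4 hf

theorem pO_count (k n m : ℕ) (hk : 20 ≤ k) (hn : (n : ℝ) ≤ (k : ℝ) ^ 2 / 2) (hn0 : 0 < n)
    (hm : (k : ℝ) ^ 2 * Real.log k * k.factorial < m + 1) :
    n.factorial * (k.factorial - 1) ^ m < k.factorial ^ m := by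
  have hkR : (20 : ℝ) ≤ k := by exact_mod_cast hk
  have hf1 : 1 ≤ k.factorial := k.factorial_pos
  have hf : (1 : ℝ) ≤ k.factorial := by exact_mod_cast hf1
  have hn0R : (0 : ℝ) < n := by exact_mod_cast hn0
  have hn1R : (1 : ℝ) ≤ n := by exact_mod_cast hn0
  have hlogn : (n : ℝ) * Real.log n ≤ (k : ℝ) ^ 2 * Real.log k - (k : ℝ) ^ 2 / 2 * Real.log 2 := by
    have a : Real.log n ≤ Real.log ((k : ℝ) ^ 2 / 2) := Real.log_le_log hn0R hn
    have b : Real.log ((k : ℝ) ^ 2 / 2) = 2 * Real.log k - Real.log 2 := by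
      rw [Real.log_div (by positivity) (by norm_num), Real.log_pow]; norm_num
    have c : 0 ≤ Real.log n := Real.log_nonneg hn1R
    calc (n : ℝ) * Real.log n ≤ (k : ℝ) ^ 2 / 2 * Real.log ((k : ℝ) ^ 2 / 2) := by gcongr
      _ = _ := by rw [b]; ring
  have hl2 : 0.69 < Real.log 2 := by have := Real.log_two_gt_d9; linarith
  have hmf : (k : ℝ) ^ 2 * Real.log k - 1 ≤ m / k.factorial := by
    rw [le_div_iff₀ (by linarith)]
    nlinarith
  have hlt : (n : ℝ) * Real.log n < m / k.factorial := by nlinarith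
  have hnf : (n.factorial : ℝ) ≤ Real.exp (n * Real.log n) := by
    rw [mul_comm, Real.exp_mul, Real.exp_log hn0R, Real.rpow_natCast]
    exact_mod_cast Nat.factorial_le_pow n
  have hq : ((k.factorial : ℝ) - 1) ^ m ≤ k.factorial ^ m * Real.exp (-(m / k.factorial)) := by
    have a : (k.factorial : ℝ) - 1 ≤ k.factorial * Real.exp (-(1 / k.factorial)) := by
      have := Real.add_one_le_exp (-(1 / (k.factorial : ℝ)))
      calc (k.factorial : ℝ) - 1 = k.factorial * (-(1 / (k.factorial : ℝ)) + 1) := by field_simp; ring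
        _ ≤ _ := by gcongr
    calc ((k.factorial : ℝ) - 1) ^ m ≤ (k.factorial * Real.exp (-(1 / k.factorial))) ^ m := by
          apply pow_le_pow_left₀ (by linarith) a
      _ = _ := by rw [mul_pow, ← Real.exp_nat_mul]; congr 2; ring
  have : (n.factorial : ℝ) * ((k.factorial : ℝ) - 1) ^ m < k.factorial ^ m := by
    calc (n.factorial : ℝ) * ((k.factorial : ℝ) - 1) ^ m
        ≤ Real.exp (n * Real.log n) * (k.factorial ^ m * Real.exp (-(m / k.factorial))) := by
          apply mul_le_mul hnf hq (pow_nonneg (by linarith) _) (Real.exp_pos _).le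
      _ = k.factorial ^ m * Real.exp (n * Real.log n - m / k.factorial) := by
          rw [sub_eq_add_neg, Real.exp_add]; ring
      _ < k.factorial ^ m * 1 := by
          have : (0 : ℝ) < (k.factorial : ℝ) ^ m := by positivity
          apply mul_lt_mul_of_pos_left _ this
          rw [Real.exp_lt_one_iff]; linarith
      _ = _ := mul_one _
  have e : ((k.factorial - 1 : ℕ) : ℝ) = (k.factorial : ℝ) - 1 := by
    rw [Nat.cast_sub hf1]; simp
  rw [← e] at this
  exact_mod_cast this

/-- For all sufficiently large `k` there exists an oriented
`k`-uniform hypergraph with Property O having at most `(k² ln k)·k!` edges. -/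
theorem upper_bound_propertyO :
    ∃ k₀ : ℕ, ∀ k : ℕ, k₀ ≤ k →
      ∃ (n : ℕ) (H : OrientedHypergraph k (Fin n)), PropertyO H ∧
        (H.edges.card : ℝ) ≤ (k : ℝ) ^ 2 * Real.log k * k.factorial := by
  have ht := tendsto_pow_const_div_const_pow_of_one_lt 3 (r := (3 / 2 : ℝ)) (by norm_num)
  have hev := ht.eventually (gt_mem_nhds (show (0 : ℝ) < 1 by norm_num))
  obtain ⟨K, hK⟩ := Filter.eventually_atTop.1 hev
  refine ⟨max K 20, fun k hk => ?_⟩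
  have hk20 : 20 ≤ k := le_of_max_le_right hk
  have hkR : (20 : ℝ) ≤ k := by exact_mod_cast hk20
  have hp : (k : ℝ) ^ 3 ≤ (3 / 2 : ℝ) ^ k := by
    have := hK k (le_of_max_le_left hk)
    rw [div_lt_one (by positivity)] at this
    exact this.le
  have hL : 0 ≤ (k : ℝ) ^ 2 * Real.log k * k.factorial := by
    have := Real.log_nonneg (show (1 : ℝ) ≤ k by linarith)
    positivity
  have hn1 : ((⌊(k : ℝ) ^ 2 / 2⌋₊ : ℕ) : ℝ) ≤ (k : ℝ) ^ 2 / 2 := Nat.floor_le (by positivity)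
  have hn2 := Nat.lt_floor_add_one ((k : ℝ) ^ 2 / 2)
  have hm1 := Nat.floor_le hL
  have hm2 := Nat.lt_floor_add_one ((k : ℝ) ^ 2 * Real.log k * k.factorial)
  generalize ⌊(k : ℝ) ^ 2 / 2⌋₊ = n at hn1 hn2
  generalize ⌊(k : ℝ) ^ 2 * Real.log k * k.factorial⌋₊ = m at hm1 hm2
  have hn0 : 0 < n := by
    have : (0 : ℝ) < n := by nlinarith
    exact_mod_cast this
  have hmc : m ≤ n.choose k := by
    have := hm1.trans (pO_choose k n hk20 (by linarith) hp)
    exact_mod_cast this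
  obtain ⟨H, hH, hc⟩ := pO_core k n m hmc (pO_count k n m hk20 hn1 hn0 hm2)
  refine ⟨n, H, hH, le_trans ?_ hm1⟩
  exact_mod_cast hc
end

section
/- No 3-tournament on a vertex set of 5 elements has Property O. -/
namespace PO

/-- code of a triple -/
def code (a b c : ℕ) : ℕ := 25 * a + 5 * b + c

/-- mask of the other five orientations of the triple coded by `n` -/
def other (a b c : ℕ) : ℕ :=
  2 ^ code a c b ||| (2 ^ code b a c ||| (2 ^ code b c a ||| (2 ^ code c a b ||| 2 ^ code c b a)))

def br (k : ℕ → ℕ → Bool) : List (ℕ × ℕ) → ℕ → ℕ → Bool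
  | [], _, _ => true
  | l :: ls, as, fb =>
    bif Nat.beq (Nat.land fb l.1) 0 then
      bif k (Nat.lor as l.1) (Nat.lor fb l.2) then br k ls as (Nat.lor fb l.1) else false
    else br k ls as fb

def go : List (ℕ × List (ℕ × ℕ)) → ℕ → ℕ → Bool
  | [], _, _ => false
  | p :: rest, as, fb =>
    bif Nat.beq (Nat.land as p.1) 0 then br (go rest) p.2 as fb else go rest as fb

def triples : List ℕ → List (ℕ × ℕ × ℕ)
  | [a, b, c, d, e] => [(a, b, c), (a, c, e), (a, b, e), (a, b, d), (a, c, d),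
      (a, d, e), (b, c, d), (c, d, e), (b, c, e), (b, d, e)]
  | _ => []

def lit (t : ℕ × ℕ × ℕ) : ℕ × ℕ := (2 ^ code t.1 t.2.1 t.2.2, other t.1 t.2.1 t.2.2)

def entry (p : List ℕ) : ℕ × List (ℕ × ℕ) :=
  (((triples p).map lit).foldr (fun l m => Nat.lor l.1 m) 0, (triples p).map lit)

def orders : List (List ℕ) :=
  [[4,2,1,3,0], [4,2,1,0,3], [4,2,3,1,0], [4,1,0,2,3], [4,1,2,0,3], [4,2,3,0,1], [3,4,2,0,1],
   [3,4,2,1,0], [4,3,2,1,0], [4,2,0,3,1], [4,3,2,0,1], [4,2,0,1,3], [4,1,3,2,0], [4,1,0,3,2],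
   [4,1,2,3,0], [4,0,2,3,1], [4,0,2,1,3], [4,0,3,2,1], [2,4,1,0,3], [3,4,0,2,1], [4,1,3,0,2],
   [4,3,0,2,1], [2,4,1,3,0], [3,4,1,2,0], [3,4,1,0,2], [4,3,1,0,2], [0,4,2,1,3], [4,3,1,2,0],
   [2,3,4,1,0], [2,4,3,1,0], [3,2,4,1,0], [0,3,4,2,1], [0,4,2,3,1], [0,2,4,1,3], [0,4,3,2,1],
   [0,2,3,4,1], [0,3,2,4,1], [3,0,4,2,1], [1,0,2,3,4], [1,0,2,4,3], [1,0,3,2,4], [1,2,0,3,4],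
   [0,2,4,3,1], [0,2,3,1,4], [1,3,0,2,4], [1,2,0,4,3], [1,2,3,0,4], [1,4,0,2,3], [1,0,3,4,2],
   [1,3,2,0,4], [1,3,0,4,2], [1,0,4,2,3], [1,4,2,0,3], [1,2,4,0,3], [0,2,1,3,4], [0,2,1,4,3],
   [1,2,3,4,0], [1,3,2,4,0], [2,1,0,3,4], [2,1,3,0,4], [3,1,2,0,4], [3,2,1,4,0], [0,3,2,1,4],
   [1,0,4,3,2], [3,0,2,4,1], [3,1,0,2,4], [1,3,4,0,2], [2,1,0,4,3], [3,2,0,4,1], [1,4,0,3,2],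
   [3,2,0,1,4], [2,0,1,3,4], [3,1,0,4,2], [3,1,2,4,0], [3,1,4,0,2], [3,1,4,2,0], [2,3,0,1,4],
   [2,1,3,4,0], [2,0,4,1,3], [2,0,3,1,4], [2,4,3,0,1], [1,2,4,3,0], [2,3,4,0,1], [2,0,1,4,3]]

set_option maxRecDepth 100000 in
theorem go_orders : go (orders.map entry) (2 ^ code 0 1 2) (other 0 1 2) = true := by
  decide +kernel

def FB (f : ℕ → Prop) (fb : ℕ) : Prop := ∀ n, fb.testBit n = true → ¬ f n

theorem FB.lor {f : ℕ → Prop} {a b : ℕ} (ha : FB f a) (hb : FB f b) : FB f (Nat.lor a b) := by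
  intro n hn
  have : (a ||| b).testBit n = true := hn
  rw [Nat.testBit_or, Bool.or_eq_true] at this
  exact this.elim (ha n) (hb n)

theorem FB.pow {f : ℕ → Prop} {a : ℕ} (ha : ¬ f a) : FB f (2 ^ a) := by
  intro n hn
  rw [Nat.testBit_two_pow] at hn
  have : a = n := by simpa using hn
  exact this ▸ ha

theorem FB.of_land {f : ℕ → Prop} {fb a : ℕ} (h : FB f fb)
    (ha : Nat.beq (Nat.land fb (2 ^ a)) 0 = false) : ¬ f a := by
  apply h
  by_contra hc
  have h0 : Nat.land fb (2 ^ a) = 0 := by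
    change fb &&& 2 ^ a = 0
    rw [Nat.and_two_pow]
    simpa using hc
  rw [h0] at ha
  exact absurd ha (by decide)

theorem br_sound {f : ℕ → Prop}
    (hf : ∀ a b c, a < 5 → b < 5 → c < 5 → f (code a b c) → FB f (other a b c)) (k : ℕ → ℕ → Bool) (Q : Prop)
    (hk : ∀ as fb, FB f fb → k as fb = true → Q) :
    ∀ (ts : List (ℕ × ℕ × ℕ)) (_ : ∀ t ∈ ts, t.1 < 5 ∧ t.2.1 < 5 ∧ t.2.2 < 5) (as fb : ℕ), FB f fb → br k (ts.map lit) as fb = true →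
      Q ∨ ∀ t ∈ ts, ¬ f (code t.1 t.2.1 t.2.2) := by
  intro ts
  induction ts with
  | nil => intro _ _ _ _ _; right; simp
  | cons t ts ih =>
    intro hts as fb hfb h
    obtain ⟨h1, h2, h3⟩ := hts t List.mem_cons_self
    replace ih := ih fun s hs => hts s (List.mem_cons_of_mem _ hs)
    rw [List.map_cons, br] at h
    by_cases ht : f (code t.1 t.2.1 t.2.2)
    · cases hb : Nat.beq (Nat.land fb (lit t).1) 0 with
      | false => exact absurd ht (hfb.of_land hb)
      | true =>
        rw [hb, cond_true] at h
        cases hk' : k (Nat.lor as (lit t).1) (Nat.lor fb (lit t).2) with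
        | false => rw [hk', cond_false] at h; exact absurd h (by decide)
        | true => exact Or.inl (hk _ _ (hfb.lor (hf _ _ _ h1 h2 h3 ht)) hk')
    · have key : Q ∨ ∀ t ∈ ts, ¬ f (code t.1 t.2.1 t.2.2) := by
        cases hb : Nat.beq (Nat.land fb (lit t).1) 0 with
        | false => rw [hb, cond_false] at h; exact ih _ _ hfb h
        | true =>
          rw [hb, cond_true] at h
          cases hk' : k (Nat.lor as (lit t).1) (Nat.lor fb (lit t).2) with
          | false => rw [hk', cond_false] at h; exact absurd h (by decide)
          | true => rw [hk', cond_true] at h; exact ih _ _ (hfb.lor (FB.pow ht)) h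
      refine key.imp id fun h' => ?_
      intro s hs
      rcases List.mem_cons.1 hs with rfl | hs
      · exact ht
      · exact h' s hs

theorem go_sound {f : ℕ → Prop}
    (hf : ∀ a b c, a < 5 → b < 5 → c < 5 → f (code a b c) → FB f (other a b c)) :
    ∀ (ps : List (List ℕ)) (_ : ∀ p ∈ ps, ∀ t ∈ triples p, t.1 < 5 ∧ t.2.1 < 5 ∧ t.2.2 < 5) (as fb : ℕ), FB f fb → go (ps.map entry) as fb = true →
      ∃ p ∈ ps, ∀ t ∈ triples p, ¬ f (code t.1 t.2.1 t.2.2) := by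
  intro ps
  induction ps with
  | nil => intro _ _ _ _ h; exact absurd h (by simp [go])
  | cons p ps ih =>
    intro hps as fb hfb h
    replace ih := ih fun s hs => hps s (List.mem_cons_of_mem _ hs)
    have ih' : ∀ as fb, FB f fb → go (ps.map entry) as fb = true →
      ∃ q ∈ p :: ps, ∀ t ∈ triples q, ¬ f (code t.1 t.2.1 t.2.2) := by
      intro as fb h1 h2
      obtain ⟨q, hq, h3⟩ := ih as fb h1 h2
      exact ⟨q, List.mem_cons_of_mem _ hq, h3⟩
    rw [List.map_cons, go] at h
    cases hb : Nat.beq (Nat.land as (entry p).1) 0 with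
    | false => rw [hb, cond_false] at h; exact ih' _ _ hfb h
    | true =>
      rw [hb, cond_true] at h
      rcases br_sound hf _ _ ih' (triples p) (hps p List.mem_cons_self) as fb hfb h with h | h
      · exact h
      · exact ⟨p, List.mem_cons_self, h⟩

set_option maxRecDepth 100000 in
theorem orders_inj : ∀ p ∈ orders, ∀ x y : Fin 5, p.idxOf x.val = p.idxOf y.val → x = y := by
  decide +kernel

set_option maxRecDepth 100000 in
theorem orders_triples : ∀ p ∈ orders, ∀ x y z : Fin 5, p.idxOf x.val < p.idxOf y.val →
    p.idxOf y.val < p.idxOf z.val → (x.val, y.val, z.val) ∈ triples p := by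
  decide +kernel

set_option maxRecDepth 100000 in
theorem orders_lt : ∀ p ∈ orders, ∀ t ∈ triples p, t.1 < 5 ∧ t.2.1 < 5 ∧ t.2.2 < 5 := by
  decide +kernel

theorem code_inj {a b c a' b' c' : ℕ} (hb : b < 5) (hc : c < 5)
    (hb' : b' < 5) (hc' : c' < 5) (h : code a b c = code a' b' c') :
    a = a' ∧ b = b' ∧ c = c' := by
  unfold code at h
  omega

end PO

/-- no `3`-tournament on a `5`-element vertex set has Property O. -/
theorem no_three_tournament_on_five {V : Type*} [Fintype V]
    (hV : Fintype.card V = 5) (H : OrientedHypergraph 3 V) (hT : IsTournament H) :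
    ¬ PropertyO H := by
  classical
  intro hO
  -- some edge exists
  obtain ⟨S, hS⟩ : ∃ S : Finset V, S.card = 3 := by
    obtain ⟨S, _, hS⟩ := Finset.exists_subset_card_eq
      (s := (Finset.univ : Finset V)) (n := 3) (by rw [Finset.card_univ, hV]; norm_num)
    exact ⟨S, hS⟩
  obtain ⟨e₀, he₀, -⟩ := hT S hS
  -- relabel
  obtain ⟨φ, hφ⟩ : ∃ φ : Fin 5 ≃ V, ∀ i : Fin 3, φ (Fin.castLE (by norm_num) i) = e₀ i := by
    let ψ : Fin 5 ≃ V := (Fintype.equivFinOfCardEq hV).symm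
    let e₁ : Fin 3 ↪ V := (Fin.castLEEmb (by norm_num : 3 ≤ 5)).trans ψ.toEmbedding
    have := Equiv.Perm.isMultiplyPretransitive V 3
    obtain ⟨g, hg⟩ := MulAction.exists_smul_eq (Equiv.Perm V) e₁ e₀
    refine ⟨ψ.trans g, fun i => ?_⟩
    rw [← hg]
    rfl
  let f : ℕ → Prop := fun n => ∃ e ∈ H.edges,
    n = PO.code (φ.symm (e 0)).val (φ.symm (e 1)).val (φ.symm (e 2)).val
  have hfc : ∀ a b c, a < 5 → b < 5 → c < 5 → f (PO.code a b c) → ∃ e ∈ H.edges,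
      (φ.symm (e 0)).val = a ∧ (φ.symm (e 1)).val = b ∧ (φ.symm (e 2)).val = c := by
    rintro a b c ha hb hc ⟨e, he, h⟩
    obtain ⟨h0, h1, h2⟩ := PO.code_inj hb hc (Fin.is_lt _) (Fin.is_lt _) h
    exact ⟨e, he, h0.symm, h1.symm, h2.symm⟩
  have hrange : ∀ e : Fin 3 ↪ V, Set.range e = {e 0, e 1, e 2} := by
    intro e
    ext x
    simp only [Set.mem_range, Fin.exists_fin_succ, Set.mem_insert_iff, Set.mem_singleton_iff]
    simp [eq_comm]
  have hf : ∀ a b c, a < 5 → b < 5 → c < 5 → f (PO.code a b c) → PO.FB f (PO.other a b c) := by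
    intro a b c ha hb hc h
    obtain ⟨e, he, rfl, rfl, rfl⟩ := hfc a b c ha hb hc h
    have n01 : e 0 ≠ e 1 := fun h => absurd (e.injective h) (by decide)
    have n02 : e 0 ≠ e 2 := fun h => absurd (e.injective h) (by decide)
    have n12 : e 1 ≠ e 2 := fun h => absurd (e.injective h) (by decide)
    have key : ∀ x y z : V, ({x, y, z} : Set V) = {e 0, e 1, e 2} →
        ¬ (x = e 0 ∧ y = e 1) →
        ¬ f (PO.code (φ.symm x).val (φ.symm y).val (φ.symm z).val) := by
      intro x y z hs hne hfx
      obtain ⟨e', he', h0, h1, h2⟩ :=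
        hfc _ _ _ (Fin.is_lt _) (Fin.is_lt _) (Fin.is_lt _) hfx
      have h0 := φ.symm.injective (Fin.val_injective h0)
      have h1 := φ.symm.injective (Fin.val_injective h1)
      have h2 := φ.symm.injective (Fin.val_injective h2)
      subst h0 h1 h2
      have := H.eq_of_range_eq e' he' e he (by rw [hrange, hrange, hs])
      subst this
      exact hne ⟨rfl, rfl⟩
    unfold PO.other
    refine PO.FB.lor (PO.FB.pow (key _ _ _ ?_ ?_)) (PO.FB.lor (PO.FB.pow (key _ _ _ ?_ ?_))
      (PO.FB.lor (PO.FB.pow (key _ _ _ ?_ ?_)) (PO.FB.lor (PO.FB.pow (key _ _ _ ?_ ?_))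
      (PO.FB.pow (key _ _ _ ?_ ?_)))))
    all_goals first
      | (ext w; simp only [Set.mem_insert_iff, Set.mem_singleton_iff]; tauto)
      | exact fun hh => n12 hh.2.symm
      | exact fun hh => n01 hh.1.symm
      | exact fun hh => n02 hh.1.symm
  have h012 : f (PO.code 0 1 2) := by
    refine ⟨e₀, he₀, ?_⟩
    rw [← hφ 0, ← hφ 1, ← hφ 2]
    simp only [Equiv.symm_apply_apply]
    rfl
  obtain ⟨p, hp, hun⟩ := PO.go_sound hf PO.orders PO.orders_lt _ _
    (hf 0 1 2 (by norm_num) (by norm_num) (by norm_num) h012) PO.go_orders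
  let idx : V → ℕ := fun x => p.idxOf (φ.symm x).val
  have hidx : Function.Injective idx := fun x y h =>
    φ.symm.injective (PO.orders_inj p hp _ _ h)
  obtain ⟨e, he, hc⟩ := hO (fun x y => idx x < idx y)
    { irrefl := fun x => lt_irrefl _
      trans := fun x y z => lt_trans
      trichotomous := fun x y h1 h2 => hidx (le_antisymm (not_lt.1 h2) (not_lt.1 h1)) }
  exact hun _ (PO.orders_triples p hp _ _ _ (hc 0 1 (by decide)) (hc 1 2 (by decide)))
    ⟨e, he, rfl⟩
end
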